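/- arXiv:1912.03377 — 5 statements merged into one kernel-verified Lean document; each statement's English description precedes it below -/
import Mathlib

section
/- Let F be a family of polynomials over ℂ, each of degree at least 2, containing a non-exceptional polynomial, and suppose every pair of elements of F shares a common iterate. Then the semigroup S(F) generated by F under composition is amenable, and moreover every right-invariant mean on S(F) is left-invariant. -/
open Polynomial

noncomputable section

/-- The `n`-fold composition iterate of a polynomial (`polyIter P 0 = X`,
`polyIter P 1 = P`, ...). -/
def polyIter (P : ℂ[X]) : ℕ → ℂ[X]
  | 0 => X
  | n + 1 => P.comp (polyIter P n)

/-- The forward orbit `O_P(z) = {P^∘n(z) : n ≥ 0}` of `z` under `P`. -/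
def fwdOrbit (P : ℂ[X]) (z : ℂ) : Set ℂ :=
  Set.range fun n : ℕ => (polyIter P n).eval z

/-- A polynomial is exceptional if it has degree ≤ 1 or is affinely conjugate
(via `ℓ(z) = a z + b`, `a ≠ 0`) to a power map `z ↦ z^n` or to a Chebyshev
polynomial `Tₙ`; the conjugacy `ℓ⁻¹ ∘ P ∘ ℓ = Q` is expressed as `P ∘ ℓ = ℓ ∘ Q`. -/
def IsExceptional (P : ℂ[X]) : Prop :=
  P.degree ≤ 1 ∨
    ∃ a b : ℂ, a ≠ 0 ∧
      ((∃ n : ℕ, P.comp (C a * X + C b) = (C a * X + C b).comp (X ^ n)) ∨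
       (∃ n : ℕ, P.comp (C a * X + C b) = (C a * X + C b).comp (Chebyshev.T ℂ n)))

/-- Membership in the semigroup generated by a family `F` of polynomials
under composition. -/
inductive InGen (F : Set ℂ[X]) : ℂ[X] → Prop
  | base {P : ℂ[X]} : P ∈ F → InGen F P
  | comp {P Q : ℂ[X]} : InGen F P → InGen F Q → InGen F (P.comp Q)

/-- The semigroup `S(F)` generated by `F` under composition, as a type. -/
def GenS (F : Set ℂ[X]) : Type := {P : ℂ[X] // InGen F P}

instance (F : Set ℂ[X]) : Semigroup (GenS F) where
  mul P Q := ⟨P.1.comp Q.1, InGen.comp P.2 Q.2⟩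
  mul_assoc a b c := Subtype.ext (Polynomial.comp_assoc a.1 b.1 c.1)

/-- A function `S → ℝ` is bounded, i.e. belongs to `ℓ∞(S)`. -/
def Bddf {S : Type*} (φ : S → ℝ) : Prop := ∃ C : ℝ, ∀ x, |φ x| ≤ C

/-- A mean on a semigroup `S`: a positive linear functional on `ℓ∞(S)` with
`M(1) = 1`.  (Its values on unbounded functions are irrelevant.) -/
structure Mean (S : Type*) [Mul S] where
  toFun : (S → ℝ) → ℝ
  map_add : ∀ φ ψ : S → ℝ, Bddf φ → Bddf ψ → toFun (φ + ψ) = toFun φ + toFun ψ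
  map_smul : ∀ (c : ℝ) (φ : S → ℝ), Bddf φ → toFun (c • φ) = c * toFun φ
  nonneg : ∀ φ : S → ℝ, Bddf φ → (∀ x, 0 ≤ φ x) → 0 ≤ toFun φ
  norm_one : toFun (fun _ => 1) = 1

/-- A mean is right-invariant if `M(x ↦ φ(x·s)) = M(φ)` for all `s`. -/
def Mean.RightInvariant {S : Type*} [Mul S] (M : Mean S) : Prop :=
  ∀ (s : S) (φ : S → ℝ), Bddf φ → M.toFun (fun x => φ (x * s)) = M.toFun φ

/-- A mean is left-invariant if `M(x ↦ φ(s·x)) = M(φ)` for all `s`. -/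
def Mean.LeftInvariant {S : Type*} [Mul S] (M : Mean S) : Prop :=
  ∀ (s : S) (φ : S → ℝ), Bddf φ → M.toFun (fun x => φ (s * x)) = M.toFun φ


section CentralElement

variable {S : Type*} [Semigroup S] {R : S}

theorem iterate_mul_left_mul (R x y : S) (a : ℕ) :
    (R * ·)^[a] x * y = (R * ·)^[a] (x * y) := by
  induction a with
  | zero => rfl
  | succ a ih => simp only [Function.iterate_succ_apply', mul_assoc, ih]

theorem mul_iterate_mul_left (hR : ∀ x, R * x = x * R) (x y : S) (a : ℕ) :
    x * (R * ·)^[a] y = (R * ·)^[a] (x * y) := by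
  induction a with
  | zero => rfl
  | succ a ih =>
    simp only [Function.iterate_succ_apply', ← ih]
    rw [← mul_assoc, ← hR, mul_assoc]

theorem iterate_mul_left_injective (hR : ∀ x, R * x = x * R)
    (hc : ∀ a b c : S, a * c = b * c → a = b) (a : ℕ) :
    Function.Injective ((R * ·)^[a] : S → S) := by
  refine Function.Injective.iterate (fun x y h => hc x y R ?_) a
  simpa only [hR] using h

/-- Two elements are related if they agree up to multiplication by powers of
the central element `R`. -/
def centralSetoid (R : S) : Setoid S where
  r x y := ∃ a b : ℕ, (R * ·)^[a] x = (R * ·)^[b] y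
  iseqv :=
    { refl := fun _ => ⟨0, 0, rfl⟩
      symm := fun ⟨a, b, h⟩ => ⟨b, a, h.symm⟩
      trans := by
        rintro x y z ⟨a, b, h⟩ ⟨c, d, h'⟩
        refine ⟨c + a, b + d, ?_⟩
        rw [Function.iterate_add_apply, h, ← Function.iterate_add_apply, add_comm,
          Function.iterate_add_apply, h', ← Function.iterate_add_apply] }

/-- The classes of `S` modulo powers of `R`. -/
abbrev CentralQuotient (R : S) : Type _ := Quotient (centralSetoid R)

/-- The class of an element modulo powers of `R`. -/
def centralClass (R x : S) : CentralQuotient R := Quotient.mk (centralSetoid R) x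

theorem centralClass_eq_iff {x y : S} :
    centralClass R x = centralClass R y ↔ ∃ a b : ℕ, (R * ·)^[a] x = (R * ·)^[b] y :=
  Quotient.eq (r := centralSetoid R)

theorem centralClass_out (h : CentralQuotient R) : centralClass R h.out = h :=
  Quotient.out_eq h

theorem centralClass_iterate (x : S) (a : ℕ) :
    centralClass R ((R * ·)^[a] x) = centralClass R x :=
  centralClass_eq_iff.2 ⟨0, a, rfl⟩

theorem centralClass_mul_right {x y : S} (s : S) (h : centralClass R x = centralClass R y) :
    centralClass R (x * s) = centralClass R (y * s) := by
  obtain ⟨a, b, h⟩ := centralClass_eq_iff.1 h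
  exact centralClass_eq_iff.2 ⟨a, b, by rw [← iterate_mul_left_mul, h, iterate_mul_left_mul]⟩

theorem centralClass_mul_left (hR : ∀ x, R * x = x * R) {x y : S} (s : S)
    (h : centralClass R x = centralClass R y) :
    centralClass R (s * x) = centralClass R (s * y) := by
  obtain ⟨a, b, h⟩ := centralClass_eq_iff.1 h
  exact centralClass_eq_iff.2
    ⟨a, b, by rw [← mul_iterate_mul_left hR, h, mul_iterate_mul_left hR]⟩

theorem centralClass_of_mul_right (hc : ∀ a b c : S, a * c = b * c → a = b) {x y s : S}
    (h : centralClass R (x * s) = centralClass R (y * s)) :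
    centralClass R x = centralClass R y := by
  obtain ⟨a, b, h⟩ := centralClass_eq_iff.1 h
  exact centralClass_eq_iff.2 ⟨a, b, hc _ _ s (by simpa only [iterate_mul_left_mul] using h)⟩

theorem bijective_out_mul [Finite (CentralQuotient R)]
    (hc : ∀ a b c : S, a * c = b * c → a = b) (s : S) :
    Function.Bijective fun h : CentralQuotient R => centralClass R (h.out * s) := by
  refine Finite.injective_iff_bijective.1 fun h h' e => ?_
  rw [← centralClass_out h, ← centralClass_out h']
  exact centralClass_of_mul_right hc e

theorem exists_mul_eq_iterate [Finite (CentralQuotient R)] (hR : ∀ x, R * x = x * R)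
    (hc : ∀ a b c : S, a * c = b * c → a = b) (s : S) :
    ∃ (t : S) (k : ℕ), t * s = (R * ·)^[k] R ∧ s * t = (R * ·)^[k] R := by
  obtain ⟨h, hh⟩ := (bijective_out_mul hc s).2 (centralClass R R)
  obtain ⟨a, b, e⟩ := centralClass_eq_iff.1 hh
  refine ⟨(R * ·)^[a] h.out, b, by rw [iterate_mul_left_mul, e], hc _ _ s ?_⟩
  rw [mul_assoc, iterate_mul_left_mul, e, mul_iterate_mul_left hR, iterate_mul_left_mul, hR]

theorem bijective_mul_out [Finite (CentralQuotient R)] (hR : ∀ x, R * x = x * R)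
    (hc : ∀ a b c : S, a * c = b * c → a = b) (s : S) :
    Function.Bijective fun h : CentralQuotient R => centralClass R (s * h.out) := by
  refine Finite.injective_iff_bijective.1 fun h h' e => ?_
  rw [← centralClass_out h, ← centralClass_out h']
  obtain ⟨t, k, ht, -⟩ := exists_mul_eq_iterate hR hc s
  have key : ∀ x : S, centralClass R (t * (s * x)) = centralClass R x := fun x => by
    rw [← mul_assoc, ht, iterate_mul_left_mul, ← Function.iterate_succ_apply (R * ·) k x,
      centralClass_iterate]
  rw [← key, ← key h'.out]
  exact centralClass_mul_left hR t e

theorem Bddf.comp {T U : Type*} {φ : T → ℝ} (hφ : Bddf φ) (f : U → T) :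
    Bddf fun x => φ (f x) := by
  obtain ⟨C, hC⟩ := hφ
  exact ⟨C, fun x => hC _⟩

theorem Bddf.add {T : Type*} {φ ψ : T → ℝ} (hφ : Bddf φ) (hψ : Bddf ψ) : Bddf (φ + ψ) := by
  obtain ⟨C, hC⟩ := hφ
  obtain ⟨D, hD⟩ := hψ
  exact ⟨C + D, fun x => (abs_add_le _ _).trans (add_le_add (hC x) (hD x))⟩

theorem Bddf.sum {T ι : Type*} (s : Finset ι) (φ : ι → T → ℝ) (hφ : ∀ i, Bddf (φ i)) :
    Bddf (∑ i ∈ s, φ i) := by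
  classical
  induction s using Finset.induction_on with
  | empty => exact ⟨0, fun x => by simp⟩
  | insert i s hi ih => rw [Finset.sum_insert hi]; exact (hφ i).add ih

theorem Bddf.indicator {T : Type*} {φ : T → ℝ} (hφ : Bddf φ) (A : Set T) :
    Bddf (A.indicator φ) := by
  obtain ⟨C, hC⟩ := hφ
  refine ⟨C, fun x => ?_⟩
  by_cases hx : x ∈ A
  · simpa [hx] using hC x
  · simpa [hx] using (abs_nonneg _).trans (hC x)

theorem Mean.map_sum (M : Mean S) {ι : Type*} (s : Finset ι) (φ : ι → S → ℝ)
    (hφ : ∀ i, Bddf (φ i)) : M.toFun (∑ i ∈ s, φ i) = ∑ i ∈ s, M.toFun (φ i) := by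
  classical
  induction s using Finset.induction_on with
  | empty =>
    have := M.map_smul 0 0 ⟨0, fun x => by simp⟩
    simpa using this
  | insert i s hi ih =>
    rw [Finset.sum_insert hi, Finset.sum_insert hi, M.map_add _ _ (hφ i) (Bddf.sum s φ hφ), ih]

theorem Mean.eq_sum_indicator [Fintype (CentralQuotient R)] (M : Mean S) {φ : S → ℝ}
    (hφ : Bddf φ) :
    M.toFun φ = ∑ h, M.toFun ({x | centralClass R x = h}.indicator φ) := by
  classical
  rw [← M.map_sum _ _ fun h => hφ.indicator _]
  congr 1
  ext x
  simp [Finset.sum_apply, Set.indicator_apply]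

theorem Mean.RightInvariant.leftInvariant_of_central [Finite (CentralQuotient R)]
    (hR : ∀ x, R * x = x * R) (hc : ∀ a b c : S, a * c = b * c → a = b) {M : Mean S}
    (hM : M.RightInvariant) : M.LeftInvariant := by
  intro s φ hφ
  have := Fintype.ofFinite (CentralQuotient R)
  rw [M.eq_sum_indicator (R := R) hφ, M.eq_sum_indicator (R := R) (hφ.comp (s * ·)),
    ← (bijective_mul_out hR hc s).sum_comp
      fun h => M.toFun ({x | centralClass R x = h}.indicator φ)]
  refine Finset.sum_congr rfl fun h _ => ?_
  obtain ⟨y', k, -, hy⟩ := exists_mul_eq_iterate hR hc h.out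
  set t := y' * (s * h.out) with ht
  have hyt : h.out * t = (R * ·)^[k + 1] (s * h.out) := by
    rw [ht, ← mul_assoc, hy, iterate_mul_left_mul, Function.iterate_succ_apply]
  have hxt : ∀ x, centralClass R x = h → x * t = (R * ·)^[k + 1] (s * x) := by
    intro x hx
    rw [← centralClass_out h] at hx
    obtain ⟨a, b, e⟩ := centralClass_eq_iff.1 hx
    apply iterate_mul_left_injective hR hc a
    rw [← iterate_mul_left_mul, e, iterate_mul_left_mul, hyt, ← Function.iterate_add_apply,
      ← Function.iterate_add_apply, add_comm, Function.iterate_add_apply,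
      ← mul_iterate_mul_left hR, ← e, mul_iterate_mul_left hR, ← Function.iterate_add_apply,
      add_comm]
  rw [← hM ((R * ·)^[k] R) _ ((hφ.comp (s * ·)).indicator _), ← hM t _ (hφ.indicator _)]
  congr 1
  ext x
  have hxR : x * (R * ·)^[k] R = (R * ·)^[k + 1] x := by
    rw [mul_iterate_mul_left hR, ← hR, Function.iterate_succ_apply]
  have hsh : centralClass R (h.out * t) = centralClass R (s * h.out) := by
    rw [hyt, centralClass_iterate]
  have hcx : centralClass R (x * (R * ·)^[k] R) = centralClass R x := by
    rw [hxR, centralClass_iterate]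
  by_cases hx : centralClass R x = h
  · have h1 : centralClass R (x * t) = centralClass R (s * h.out) := by
      rw [hxt x hx, centralClass_iterate]
      exact centralClass_mul_left hR s (hx.trans (centralClass_out h).symm)
    rw [Set.indicator_of_mem (s := {x | centralClass R x = h}) (hcx.trans hx),
      Set.indicator_of_mem (s := {x | centralClass R x = centralClass R (s * h.out)}) h1, hxt x hx, hxR,
      mul_iterate_mul_left hR]
  · have h1 : centralClass R (x * t) ≠ centralClass R (s * h.out) := fun h1 =>
      hx ((centralClass_of_mul_right hc (h1.trans hsh.symm)).trans (centralClass_out h))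
    rw [Set.indicator_of_notMem (s := {x | centralClass R x = h}) fun h2 => hx (hcx.symm.trans h2),
      Set.indicator_of_notMem (s := {x | centralClass R x = centralClass R (s * h.out)}) h1]

end CentralElement

section BanachLimit

open Filter Topology

/-- The Cesàro averages of a real sequence. -/
def cesaro (f : ℕ → ℝ) (n : ℕ) : ℝ := (∑ j ∈ Finset.range (n + 1), f j) / (n + 1)

/-- A Banach limit: the limit of the Cesàro averages along a free ultrafilter. -/
def banachLim (f : ℕ → ℝ) : ℝ := limUnder (hyperfilter ℕ : Filter ℕ) (cesaro f)

theorem abs_cesaro_le {f : ℕ → ℝ} {c : ℝ} (hf : ∀ n, |f n| ≤ c) (n : ℕ) : |cesaro f n| ≤ c := by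
  have hn : (0 : ℝ) < n + 1 := by positivity
  rw [cesaro, abs_div, abs_of_pos hn, div_le_iff₀ hn]
  calc |∑ j ∈ Finset.range (n + 1), f j| ≤ ∑ j ∈ Finset.range (n + 1), |f j| :=
        Finset.abs_sum_le_sum_abs _ _
    _ ≤ ∑ _j ∈ Finset.range (n + 1), c := Finset.sum_le_sum fun j _ => hf j
    _ = c * (n + 1) := by simp [mul_comm]

theorem tendsto_banachLim {f : ℕ → ℝ} (hf : Bddf f) :
    Tendsto (cesaro f) (hyperfilter ℕ) (𝓝 (banachLim f)) := by
  obtain ⟨c, hc⟩ := hf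
  obtain ⟨l, -, hl⟩ := (isCompact_Icc (a := -c) (b := c)).ultrafilter_le_nhds
    ((hyperfilter ℕ).map (cesaro f)) (by
      rw [le_principal_iff]
      exact Filter.univ_mem' (f := (hyperfilter ℕ : Filter ℕ)) fun n =>
        abs_le.1 (abs_cesaro_le hc n))
  exact tendsto_nhds_limUnder ⟨l, hl⟩

theorem banachLim_eq {f : ℕ → ℝ} {l : ℝ}
    (h : Tendsto (cesaro f) (hyperfilter ℕ) (𝓝 l)) : banachLim f = l :=
  h.limUnder_eq

theorem banachLim_add {f g : ℕ → ℝ} (hf : Bddf f) (hg : Bddf g) :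
    banachLim (f + g) = banachLim f + banachLim g := by
  refine banachLim_eq (((tendsto_banachLim hf).add (tendsto_banachLim hg)).congr fun n => ?_)
  simp [cesaro, Finset.sum_add_distrib, add_div]

theorem banachLim_smul (c : ℝ) {f : ℕ → ℝ} (hf : Bddf f) :
    banachLim (c • f) = c * banachLim f := by
  refine banachLim_eq (((tendsto_banachLim hf).const_mul c).congr fun n => ?_)
  simp [cesaro, ← Finset.mul_sum, mul_div_assoc]

theorem banachLim_nonneg {f : ℕ → ℝ} (hf : Bddf f) (h : ∀ n, 0 ≤ f n) : 0 ≤ banachLim f :=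
  ge_of_tendsto' (tendsto_banachLim hf) fun n =>
    div_nonneg (Finset.sum_nonneg fun j _ => h j) (by positivity)

theorem banachLim_one : banachLim (fun _ => 1) = 1 := by
  refine banachLim_eq (tendsto_const_nhds.congr fun n => ?_)
  have hn : (n + 1 : ℝ) ≠ 0 := by positivity
  simp [cesaro, hn]

theorem banachLim_succ {f : ℕ → ℝ} (hf : Bddf f) : banachLim (fun n => f (n + 1)) = banachLim f := by
  obtain ⟨c, hc⟩ := id hf
  have h0 : Tendsto (fun n : ℕ => (f (n + 1) - f 0) / (n + 1 : ℝ)) atTop (𝓝 0) := by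
    have h1 : Tendsto (fun n : ℕ => 2 * c * (1 / ((n : ℝ) + 1))) atTop (𝓝 0) := by
      simpa using (tendsto_one_div_add_atTop_nhds_zero_nat (𝕜 := ℝ)).const_mul (2 * c)
    refine squeeze_zero_norm (fun n => ?_) h1
    have hn : (0 : ℝ) < n + 1 := by positivity
    rw [Real.norm_eq_abs, abs_div, abs_of_pos hn, mul_one_div]
    gcongr
    have := abs_sub (f (n + 1)) (f 0)
    linarith [hc (n + 1), hc 0]
  refine banachLim_eq ?_
  have h2 := (tendsto_banachLim hf).add (h0.mono_left Nat.hyperfilter_le_atTop)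
  rw [add_zero] at h2
  refine h2.congr fun n => ?_
  simp only [cesaro]
  rw [← add_div]
  congr 1
  have := Finset.sum_range_succ f (n + 1)
  rw [Finset.sum_range_succ' f (n + 1)] at this
  linarith

theorem banachLim_shift {f : ℕ → ℝ} (hf : Bddf f) (a : ℕ) :
    banachLim (fun n => f (n + a)) = banachLim f := by
  induction a with
  | zero => rfl
  | succ a ih =>
    rw [← ih, ← banachLim_succ (hf.comp (· + a))]
    congr 1
    ext n
    congr 1
    ring

end BanachLimit

section CentralMean

variable {S : Type*} [Semigroup S] {R : S}

/-- The mean obtained by averaging Banach limits along the orbits of `R`. -/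
def centralMean (R : S) [Fintype (CentralQuotient R)] : Mean S where
  toFun φ := (∑ h : CentralQuotient R, banachLim fun n => φ ((R * ·)^[n] h.out)) /
    Fintype.card (CentralQuotient R)
  map_add φ ψ hφ hψ := by
    rw [← add_div, ← Finset.sum_add_distrib]
    congr 1
    exact Finset.sum_congr rfl fun h _ => banachLim_add (hφ.comp _) (hψ.comp _)
  map_smul c φ hφ := by
    rw [← mul_div_assoc, Finset.mul_sum]
    congr 1
    exact Finset.sum_congr rfl fun h _ => banachLim_smul c (hφ.comp _)
  nonneg φ hφ h := div_nonneg
    (Finset.sum_nonneg fun _ _ => banachLim_nonneg (hφ.comp _) fun _ => h _) (by positivity)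
  norm_one := by
    have : Nonempty (CentralQuotient R) := ⟨centralClass R R⟩
    simp [banachLim_one]

theorem centralMean_rightInvariant [Fintype (CentralQuotient R)]
    (hc : ∀ a b c : S, a * c = b * c → a = b) : (centralMean R).RightInvariant := by
  intro s φ hφ
  simp only [centralMean]
  congr 1
  rw [← (bijective_out_mul hc s).sum_comp
    fun h : CentralQuotient R => banachLim fun n => φ ((R * ·)^[n] h.out)]
  refine Finset.sum_congr rfl fun h _ => ?_
  obtain ⟨a, b, e⟩ := centralClass_eq_iff.1 (centralClass_out (centralClass R (h.out * s))).symm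
  rw [← banachLim_shift (hφ.comp fun n => (R * ·)^[n] h.out * s) a,
    ← banachLim_shift (hφ.comp fun n => (R * ·)^[n] (centralClass R (h.out * s)).out) b]
  congr 1
  ext n
  rw [iterate_mul_left_mul, Function.iterate_add_apply, e, ← Function.iterate_add_apply]

theorem amenable_of_central (hR : ∀ x, R * x = x * R)
    (hc : ∀ a b c : S, a * c = b * c → a = b) {ι : Type*} [Finite ι] (f : S → ι)
    (hf : ∀ x y, f x = f y → ∃ a b : ℕ, (R * ·)^[a] x = (R * ·)^[b] y) :
    (∃ M : Mean S, M.RightInvariant ∧ M.LeftInvariant) ∧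
      (∀ M : Mean S, M.RightInvariant → M.LeftInvariant) := by
  have : Finite (CentralQuotient R) :=
    Finite.of_injective (fun h : CentralQuotient R => f h.out) fun h h' e => by
      rw [← centralClass_out h, ← centralClass_out h']
      exact centralClass_eq_iff.2 (hf _ _ e)
  have := Fintype.ofFinite (CentralQuotient R)
  have hl := fun M : Mean S => Mean.RightInvariant.leftInvariant_of_central (M := M) hR hc
  have hr := centralMean_rightInvariant (R := R) hc
  exact ⟨⟨centralMean R, hr, hl _ hr⟩, hl⟩

end CentralMean

section Composition

theorem comp_right_cancel {P Q A : ℂ[X]} (hA : A.natDegree ≠ 0) (h : P.comp A = Q.comp A) :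
    P = Q := by
  rw [← sub_eq_zero, ← sub_comp, comp_eq_zero_iff] at h
  rcases h with h | ⟨-, h⟩
  · exact sub_eq_zero.1 h
  · exact absurd (h ▸ natDegree_C _) hA

theorem polyIter_one (P : ℂ[X]) : polyIter P 1 = P := comp_X

theorem polyIter_add (P : ℂ[X]) (m n : ℕ) :
    polyIter P (m + n) = (polyIter P m).comp (polyIter P n) := by
  induction m with
  | zero => simp [polyIter]
  | succ m ih => rw [Nat.succ_add, polyIter, polyIter, ih, comp_assoc]

theorem polyIter_mul (P : ℂ[X]) (m n : ℕ) :
    polyIter P (m * n) = polyIter (polyIter P m) n := by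
  induction n with
  | zero => rfl
  | succ n ih => rw [Nat.mul_succ, add_comm, polyIter_add, ih, polyIter]

theorem comp_polyIter_of_comm {P Q : ℂ[X]} (h : P.comp Q = Q.comp P) (n : ℕ) :
    P.comp (polyIter Q n) = (polyIter Q n).comp P := by
  induction n with
  | zero => simp [polyIter]
  | succ n ih => rw [polyIter, ← comp_assoc, h, comp_assoc, ih, comp_assoc]

theorem natDegree_polyIter (P : ℂ[X]) (n : ℕ) :
    (polyIter P n).natDegree = P.natDegree ^ n := by
  induction n with
  | zero => simp [polyIter]
  | succ n ih => rw [polyIter, natDegree_comp, ih, pow_succ']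

theorem monic_polyIter {P : ℂ[X]} (hP : P.Monic) (hd : 2 ≤ P.natDegree) (n : ℕ) :
    (polyIter P n).Monic := by
  induction n with
  | zero => exact monic_X
  | succ n ih =>
    exact hP.comp ih (by rw [natDegree_polyIter]; positivity)

/-- A monic polynomial of degree at least `2` whose roots have barycentre `0`. -/
structure IsCentered (T : ℂ[X]) : Prop where
  monic : T.Monic
  two_le : 2 ≤ T.natDegree
  nextCoeff : T.nextCoeff = 0

theorem IsCentered.natDegree_sub_le {T : ℂ[X]} (hT : IsCentered T) :
    (T - X ^ T.natDegree).natDegree ≤ T.natDegree - 2 := by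
  have h2 := hT.two_le
  have hn := hT.nextCoeff
  rw [nextCoeff_of_natDegree_pos (by omega)] at hn
  rw [natDegree_le_iff_coeff_eq_zero]
  intro i hi
  rw [coeff_sub, coeff_X_pow]
  rcases lt_trichotomy i T.natDegree with h | h | h
  · rw [show i = T.natDegree - 1 by omega, hn, if_neg (by omega), sub_zero]
  · rw [if_pos h, h, hT.monic.coeff_natDegree, sub_self]
  · rw [if_neg h.ne', coeff_eq_zero_of_natDegree_lt h, sub_zero]

theorem IsCentered.comp {P T : ℂ[X]} (hP : IsCentered P) (hT : IsCentered T) :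
    IsCentered (P.comp T) := by
  have hP2 := hP.two_le
  have hT2 := hT.two_le
  have hd : (P.comp T).natDegree = P.natDegree * T.natDegree := natDegree_comp
  refine ⟨hP.monic.comp hT.monic (by omega), by rw [hd]; nlinarith, ?_⟩
  set n := P.natDegree
  have hsum : P.comp T = T ^ n + (P - X ^ n).comp T := by simp
  have h1 : (T ^ n).coeff (n * T.natDegree - 1) = 0 := by
    have h := hT.monic.nextCoeff_pow n
    rw [hT.nextCoeff, nsmul_zero, nextCoeff_of_natDegree_pos (by rw [natDegree_pow]; positivity),
      natDegree_pow] at h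
    exact h
  have h2 : ((P - X ^ n).comp T).coeff (n * T.natDegree - 1) = 0 := by
    apply coeff_eq_zero_of_natDegree_lt
    rw [natDegree_comp]
    refine (Nat.mul_le_mul_right _ hP.natDegree_sub_le).trans_lt ?_
    change (n - 2) * T.natDegree < _
    obtain ⟨m, hm⟩ : ∃ m, n = m + 2 := ⟨n - 2, by omega⟩
    rw [hm, Nat.add_sub_cancel, add_mul]
    omega
  rw [nextCoeff_of_natDegree_pos (by rw [hd]; positivity), hd, hsum, coeff_add, h1, h2, add_zero]

theorem IsCentered.polyIter {P : ℂ[X]} (hP : IsCentered P) {n : ℕ} (hn : 1 ≤ n) :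
    IsCentered (polyIter P n) := by
  induction n, hn using Nat.le_induction with
  | base => rwa [polyIter_one]
  | succ n _ ih => exact hP.comp ih

theorem leadingCoeff_pow_eq_of_comm {T P : ℂ[X]} (hT : IsCentered T)
    (hP : P.comp T = T.comp P) (hd : P.natDegree ≠ 0) :
    P.leadingCoeff ^ T.natDegree = P.leadingCoeff := by
  have h2 := hT.two_le
  have h := congrArg leadingCoeff hP
  rw [leadingCoeff_comp (by omega), leadingCoeff_comp hd, hT.monic, one_pow, mul_one,
    one_mul] at h
  exact h.symm

/-- Two polynomials of the same degree commuting with a centered polynomial are proportional. -/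
theorem eq_C_mul_of_comm {T P Q : ℂ[X]} (hT : IsCentered T) (hP : P.comp T = T.comp P)
    (hQ : Q.comp T = T.comp Q) (hd : Q.natDegree = P.natDegree) (hd0 : P.natDegree ≠ 0) :
    Q = C (Q.leadingCoeff / P.leadingCoeff) * P := by
  have hp := leadingCoeff_pow_eq_of_comm hT hP hd0
  have hq := leadingCoeff_pow_eq_of_comm hT hQ (hd ▸ hd0)
  have hP0 : P.leadingCoeff ≠ 0 := by
    rw [Ne, leadingCoeff_eq_zero]; rintro rfl; simp at hd0
  have hQ0 : Q.leadingCoeff ≠ 0 := by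
    rw [Ne, leadingCoeff_eq_zero]; rintro rfl; simp at hd; omega
  set η := Q.leadingCoeff / P.leadingCoeff with hη
  have hη0 : η ≠ 0 := div_ne_zero hQ0 hP0
  have hηN : η ^ T.natDegree = η := by rw [hη, div_pow, hp, hq]
  obtain ⟨M, hM⟩ : ∃ M, T.natDegree = M + 2 := ⟨T.natDegree - 2, by have := hT.two_le; omega⟩
  set A := C η * P with hA
  have hAd : A.natDegree = P.natDegree := natDegree_C_mul hη0
  have hAl : A.leadingCoeff = Q.leadingCoeff := by
    rw [hA, leadingCoeff_mul, leadingCoeff_C, hη, div_mul_cancel₀ _ hP0]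
  by_contra hne
  have hD0 : Q - A ≠ 0 := sub_ne_zero.2 hne
  have hQne : Q ≠ 0 := leadingCoeff_ne_zero.1 hQ0
  have hAne : A ≠ 0 := leadingCoeff_ne_zero.1 (hAl ▸ hQ0)
  have he : (Q - A).natDegree < P.natDegree := by
    rw [← hd]
    refine natDegree_lt_natDegree hD0 (degree_sub_lt_left ?_ hQne hAl.symm)
    rw [degree_eq_natDegree hQne, degree_eq_natDegree hAne, hd, hAd]
  set G := ∑ i ∈ Finset.range (M + 2), Q ^ i * A ^ (M + 2 - 1 - i) with hG
  have hGc : G.coeff ((M + 1) * P.natDegree) ≠ 0 := by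
    have h1 : ∀ i ∈ Finset.range (M + 2), (Q ^ i * A ^ (M + 2 - 1 - i)).coeff
        ((M + 1) * P.natDegree) = Q.leadingCoeff ^ (M + 1) := by
      intro i hi
      have hi' : i + (M + 2 - 1 - i) = M + 1 := by have := Finset.mem_range.1 hi; omega
      have hdeg : (Q ^ i * A ^ (M + 2 - 1 - i)).natDegree = (M + 1) * P.natDegree := by
        rw [natDegree_mul (pow_ne_zero _ hQne) (pow_ne_zero _ hAne), natDegree_pow,
          natDegree_pow, hd, hAd, ← add_mul, hi']
      rw [← hdeg, coeff_natDegree, leadingCoeff_mul, leadingCoeff_pow, leadingCoeff_pow, hAl,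
        ← pow_add, hi']
    rw [hG, finsetSum_coeff, Finset.sum_congr rfl h1, Finset.sum_const, Finset.card_range,
      nsmul_eq_mul]
    exact mul_ne_zero (Nat.cast_ne_zero.2 (Nat.succ_ne_zero _)) (pow_ne_zero _ hQ0)
  have hGd : (M + 1) * P.natDegree ≤ G.natDegree := le_natDegree_of_ne_zero hGc
  have hG0 : G ≠ 0 := by rintro h; simp [h] at hGc
  set r := T - X ^ (M + 2) with hr
  have hrd : r.natDegree ≤ M := by simpa [hM] using hT.natDegree_sub_le
  have hTr : T = X ^ (M + 2) + r := by rw [hr]; ring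
  set E := r.comp Q - C η * r.comp P with hE
  have key : (Q - A) * G = (Q - A).comp T - E := by
    have h1 : G * (Q - A) = Q ^ (M + 2) - A ^ (M + 2) := geom_sum₂_mul Q A (M + 2)
    have h2 : A ^ (M + 2) = C η * P ^ (M + 2) := by
      rw [hA, mul_pow, ← C_pow, ← hM, hηN]
    have h3 : ∀ B : ℂ[X], T.comp B = B ^ (M + 2) + r.comp B := fun B => by
      conv_lhs => rw [hTr]
      simp
    rw [mul_comm, h1, h2, sub_comp, hA, mul_comp, C_comp, hP, hQ, h3, h3, hE]
    ring
  have hEd : E.natDegree ≤ M * P.natDegree := by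
    refine (natDegree_sub_le _ _).trans (max_le ?_ ?_)
    · rw [natDegree_comp, hd]; exact Nat.mul_le_mul_right _ hrd
    · rw [natDegree_C_mul hη0, natDegree_comp]; exact Nat.mul_le_mul_right _ hrd
  have hfin : (Q - A).natDegree + G.natDegree ≤ max ((Q - A).natDegree * (M + 2)) E.natDegree := by
    rw [← natDegree_mul hD0 hG0, key, ← hM, ← natDegree_comp]
    exact natDegree_sub_le _ _
  rcases le_max_iff.1 hfin with h | h <;> nlinarith

theorem eq_of_comm {T P Q : ℂ[X]} (hT : IsCentered T) (hP : P.comp T = T.comp P)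
    (hQ : Q.comp T = T.comp Q) (hd : Q.natDegree = P.natDegree) (hd0 : P.natDegree ≠ 0)
    (hl : Q.leadingCoeff = P.leadingCoeff) : Q = P := by
  have hP0 : P.leadingCoeff ≠ 0 := by
    rw [Ne, leadingCoeff_eq_zero]; rintro rfl; simp at hd0
  rw [eq_C_mul_of_comm hT hP hQ hd hd0, hl, div_self hP0, C_1, one_mul]

theorem leadingCoeff_pow_factorial_eq_one {P x : ℂ[X]} (hP : IsCentered P)
    (hPX : P ≠ X ^ P.natDegree) {k : ℕ} (hk : 1 ≤ k)
    (hx : x.comp (polyIter P k) = (polyIter P k).comp x) (hd : x.natDegree ≠ 0) :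
    x.leadingCoeff ^ ((P.natDegree - 1) * P.natDegree.factorial) = 1 := by
  have h2 := hP.two_le
  have hT := hP.polyIter hk
  have hPT : P.comp (polyIter P k) = (polyIter P k).comp P := comp_polyIter_of_comm rfl k
  set T := polyIter P k
  have hx0 : x.leadingCoeff ≠ 0 := by
    rw [Ne, leadingCoeff_eq_zero]; rintro rfl; simp at hd
  have hxP : (x.comp P).comp T = T.comp (x.comp P) := by
    rw [comp_assoc, hPT, ← comp_assoc, hx, comp_assoc]
  have hPx : (P.comp x).comp T = T.comp (P.comp x) := by
    rw [comp_assoc, hx, ← comp_assoc, hPT, comp_assoc]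
  have hPxd : (P.comp x).natDegree ≠ 0 := by
    rw [natDegree_comp]; exact mul_ne_zero (by omega) hd
  have h := eq_C_mul_of_comm hT hPx hxP (by rw [natDegree_comp, natDegree_comp, mul_comm]) hPxd
  have hη : (x.comp P).leadingCoeff / (P.comp x).leadingCoeff
      = x.leadingCoeff / x.leadingCoeff ^ P.natDegree := by
    rw [leadingCoeff_comp (by omega), leadingCoeff_comp hd, hP.monic, one_pow, mul_one, one_mul]
  rw [hη] at h
  set η := x.leadingCoeff / x.leadingCoeff ^ P.natDegree
  have hη0 : η ≠ 0 := div_ne_zero hx0 (pow_ne_zero _ hx0)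
  have hTη : T.comp (C η * X) = C η * T := by
    apply comp_right_cancel hPxd
    rw [comp_assoc, mul_comp, mul_comp, C_comp, X_comp, ← h, ← hxP, h, mul_comp, C_comp, hPx]
  have hQ : (P.comp (C η * X)).comp T = T.comp (P.comp (C η * X)) := by
    rw [comp_assoc, mul_comp, C_comp, X_comp, ← hTη, ← comp_assoc, hPT, comp_assoc]
  have hQP := eq_C_mul_of_comm hT hPT hQ
    (by rw [natDegree_comp, natDegree_C_mul_X _ hη0, mul_one]) (by omega)
  set c := (P.comp (C η * X)).leadingCoeff / P.leadingCoeff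
  have hcoeff : ∀ i, P.coeff i * η ^ i = c * P.coeff i := fun i => by
    rw [← comp_C_mul_X_coeff, ← coeff_C_mul, ← hQP]
  have hc : c = η ^ P.natDegree := by
    have := hcoeff P.natDegree
    rwa [hP.monic.coeff_natDegree, one_mul, mul_one, eq_comm] at this
  obtain ⟨i, hi, hi0⟩ : ∃ i < P.natDegree, P.coeff i ≠ 0 := by
    by_contra! hcon
    refine hPX (ext fun i => ?_)
    rw [coeff_X_pow]
    rcases lt_trichotomy i P.natDegree with h | h | h
    · rw [if_neg h.ne, hcon i h]
    · rw [if_pos h, h, hP.monic.coeff_natDegree]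
    · rw [if_neg h.ne', coeff_eq_zero_of_natDegree_lt h]
  have hη1 : η ^ (P.natDegree - i) = 1 := by
    have h3 : η ^ i = η ^ P.natDegree := by
      apply mul_left_cancel₀ hi0
      rw [hcoeff, hc, mul_comm]
    apply mul_left_cancel₀ (pow_ne_zero i hη0)
    rw [← pow_add, Nat.add_sub_cancel' hi.le, mul_one, h3]
  have hηf : η ^ P.natDegree.factorial = 1 := by
    obtain ⟨m, hm⟩ := Nat.dvd_factorial (Nat.sub_pos_of_lt hi) (Nat.sub_le P.natDegree i)
    rw [hm, pow_mul, hη1, one_pow]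
  have h4 : x.leadingCoeff ^ (P.natDegree - 1) = η⁻¹ := by
    rw [inv_div, eq_div_iff hx0, ← pow_succ, Nat.sub_add_cancel (by omega)]
  rw [pow_mul, h4, inv_pow, hηf, inv_one]

/-- Some iterate of `P` commutes with every polynomial that commutes with an iterate of `P`. -/
theorem exists_uniform_commuting_iterate {P : ℂ[X]} (hP : IsCentered P)
    (hPX : P ≠ X ^ P.natDegree) :
    ∃ L : ℕ, 1 ≤ L ∧ ∀ (x : ℂ[X]) (k : ℕ), 1 ≤ k → x.natDegree ≠ 0 →
      x.comp (polyIter P k) = (polyIter P k).comp x →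
        x.comp (polyIter P L) = (polyIter P L).comp x := by
  have h2 := hP.two_le
  set M := (P.natDegree - 1) * P.natDegree.factorial with hM
  have hM0 : 0 < M := Nat.mul_pos (by omega) (Nat.factorial_pos _)
  refine ⟨M.factorial, Nat.factorial_pos _, fun x k hk hd hx => ?_⟩
  have hp := leadingCoeff_pow_factorial_eq_one hP hPX hk hx hd
  have hpk := leadingCoeff_pow_eq_of_comm (hP.polyIter hk) hx hd
  have hx0 : x.leadingCoeff ≠ 0 := by
    rw [Ne, leadingCoeff_eq_zero]; rintro rfl; simp at hd
  rw [natDegree_polyIter] at hpk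
  have hcop : Nat.Coprime P.natDegree (orderOf x.leadingCoeff) := by
    have hdvd : orderOf x.leadingCoeff ∣ P.natDegree ^ k - 1 := by
      apply orderOf_dvd_of_pow_eq_one
      apply mul_left_cancel₀ hx0
      rw [← pow_succ', Nat.sub_add_cancel (Nat.one_le_pow _ _ (by omega)), hpk, mul_one]
    refine Nat.Coprime.coprime_dvd_right hdvd ?_
    refine Nat.Coprime.coprime_dvd_left (dvd_pow_self _ (by omega : k ≠ 0)) ?_
    have h1 : 1 ≤ P.natDegree ^ k := Nat.one_le_pow _ _ (by omega)
    exact (Nat.coprime_self_sub_right h1).2 (Nat.coprime_one_right _)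
  have ho : 0 < orderOf x.leadingCoeff :=
    orderOf_pos_iff.2 (isOfFinOrder_iff_pow_eq_one.2 ⟨M, hM0, hp⟩)
  have hpL : x.leadingCoeff ^ P.natDegree ^ M.factorial = x.leadingCoeff := by
    conv_rhs => rw [← pow_one x.leadingCoeff]
    refine pow_eq_pow_of_modEq ?_ (pow_orderOf_eq_one _)
    obtain ⟨c, hc⟩ : (orderOf x.leadingCoeff).totient ∣ M.factorial :=
      Nat.dvd_factorial (Nat.totient_pos.2 ho)
        ((Nat.totient_le _).trans (Nat.le_of_dvd hM0 (orderOf_dvd_of_pow_eq_one hp)))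
    rw [hc, pow_mul]
    simpa using (Nat.ModEq.pow_totient hcop).pow c
  have hRd : (polyIter P M.factorial).natDegree ≠ 0 := by
    rw [natDegree_polyIter]; positivity
  have hRT : (polyIter P M.factorial).comp (polyIter P k)
      = (polyIter P k).comp (polyIter P M.factorial) := by
    rw [← polyIter_add, ← polyIter_add, add_comm]
  refine eq_of_comm (hP.polyIter hk) ?_ ?_ ?_ ?_ ?_
  · rw [comp_assoc, hx, ← comp_assoc, hRT, comp_assoc]
  · rw [comp_assoc, hRT, ← comp_assoc, hx, comp_assoc]
  · rw [natDegree_comp, natDegree_comp, mul_comm]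
  · rw [natDegree_comp]; exact mul_ne_zero hRd hd
  · rw [leadingCoeff_comp hRd, leadingCoeff_comp hd, monic_polyIter hP.monic h2,
      natDegree_polyIter, hpL, one_pow, mul_one, one_mul]

end Composition

section Semigroup

variable {S : Type*} [Semigroup S]

theorem map_iterate_mul_left {Φ : S → ℂ[X]} (hmul : ∀ x y, Φ (x * y) = (Φ x).comp (Φ y))
    (R x : S) (j : ℕ) : Φ ((R * ·)^[j] x) = (polyIter (Φ R) j).comp (Φ x) := by
  induction j with
  | zero => simp [polyIter]
  | succ j ih => rw [Function.iterate_succ_apply', hmul, ih, polyIter, comp_assoc]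

theorem pow_factorization_eq {n d a b : ℕ} (ha : a ≠ 0) (h : d ^ a = n ^ b) (q : ℕ) :
    d ^ n.factorization q = n ^ d.factorization q := by
  apply Nat.pow_left_injective ha
  have hv : a * d.factorization q = b * n.factorization q := by
    simpa using congrArg (fun m => m.factorization q) h
  change (d ^ n.factorization q) ^ a = (n ^ d.factorization q) ^ a
  rw [← pow_mul, mul_comm, pow_mul, h, ← pow_mul, ← hv, ← pow_mul, mul_comm]

theorem amenable_of_isCentered {Φ : S → ℂ[X]} (hΦ : Function.Injective Φ)
    (hmul : ∀ x y, Φ (x * y) = (Φ x).comp (Φ y)) {p : S} (hP : IsCentered (Φ p))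
    (hPX : Φ p ≠ X ^ (Φ p).natDegree)
    (hdeg : ∀ x, ∃ a b : ℕ, 1 ≤ a ∧ (Φ x).natDegree ^ a = (Φ p).natDegree ^ b)
    (hcomm : ∀ x, ∃ k : ℕ, 1 ≤ k ∧
      (Φ x).comp (polyIter (Φ p) k) = (polyIter (Φ p) k).comp (Φ x)) :
    (∃ M : Mean S, M.RightInvariant ∧ M.LeftInvariant) ∧
      (∀ M : Mean S, M.RightInvariant → M.LeftInvariant) := by
  have h2 := hP.two_le
  obtain ⟨L, hL, hcen⟩ := exists_uniform_commuting_iterate hP hPX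
  have hd0 : ∀ x, (Φ x).natDegree ≠ 0 := fun x h0 => by
    obtain ⟨a, b, ha, hab⟩ := hdeg x
    rw [h0, zero_pow (by omega)] at hab
    exact (pow_pos (by omega : 0 < (Φ p).natDegree) b).ne hab
  set R : S := (p * ·)^[L - 1] p
  have hΦR : Φ R = polyIter (Φ p) L := by
    conv_rhs => rw [← Nat.sub_add_cancel hL, polyIter_add, polyIter_one]
    exact map_iterate_mul_left hmul p p (L - 1)
  have hRcen : IsCentered (Φ R) := hΦR ▸ hP.polyIter hL
  have hRcomm : ∀ x, (Φ x).comp (Φ R) = (Φ R).comp (Φ x) := fun x => by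
    obtain ⟨k, hk, hx⟩ := hcomm x
    rw [hΦR]
    exact hcen _ k hk (hd0 x) hx
  set q := (Φ p).natDegree.minFac
  set w := (Φ p).natDegree.factorization q
  have hq : q.Prime := Nat.minFac_prime (by omega)
  have hw : 0 < w := hq.factorization_pos_of_dvd (by omega) (Nat.minFac_dvd _)
  set m := ((Φ p).natDegree - 1) * (Φ p).natDegree.factorial
  have hm : 0 < m := Nat.mul_pos (by omega) (Nat.factorial_pos _)
  have hroot : ∀ x, (Φ x).leadingCoeff ∈ nthRootsFinset m (1 : ℂ) := fun x => by
    obtain ⟨k, hk, hx⟩ := hcomm x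
    exact (mem_nthRootsFinset hm _).2 (leadingCoeff_pow_factorial_eq_one hP hPX hk hx (hd0 x))
  have hdegw : ∀ x, (Φ x).natDegree ^ w = (Φ p).natDegree ^ (Φ x).natDegree.factorization q :=
    fun x => by
      obtain ⟨a, b, ha, hab⟩ := hdeg x
      exact pow_factorization_eq (by omega) hab q
  refine amenable_of_central (R := R) (fun x => hΦ ?_) (fun a b c h => hΦ ?_)
    (ι := nthRootsFinset m (1 : ℂ) × Fin (L * w))
    (fun x => (⟨_, hroot x⟩, ⟨(Φ x).natDegree.factorization q % (L * w),
      Nat.mod_lt _ (Nat.mul_pos hL hw)⟩)) fun x y h => ?_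
  · rw [hmul, hmul, hRcomm]
  · exact comp_right_cancel (hd0 c) (by rw [← hmul, ← hmul, h])
  · simp only [Prod.mk.injEq, Subtype.mk.injEq, Fin.mk.injEq] at h
    obtain ⟨hlc, hmod⟩ := h
    have main : ∀ x y, (Φ x).leadingCoeff = (Φ y).leadingCoeff →
        (Φ x).natDegree.factorization q ≡ (Φ y).natDegree.factorization q [MOD L * w] →
        (Φ x).natDegree.factorization q ≤ (Φ y).natDegree.factorization q →
        ∃ a b : ℕ, (R * ·)^[a] x = (R * ·)^[b] y := by
      intro x y hlc hmod hle
      obtain ⟨j, hj⟩ := (Nat.modEq_iff_dvd' hle).1 hmod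
      refine ⟨j, 0, hΦ ?_⟩
      rw [map_iterate_mul_left hmul]
      have hc := comp_polyIter_of_comm (hRcomm x) j
      have hRj : (polyIter (Φ R) j).comp (Φ R) = (Φ R).comp (polyIter (Φ R) j) :=
        (comp_polyIter_of_comm rfl j).symm
      refine eq_of_comm hRcen (hRcomm y) ?_ ?_ (hd0 y) ?_
      · rw [comp_assoc, hRcomm, ← comp_assoc, hRj, comp_assoc]
      · apply Nat.pow_left_injective hw.ne'
        change ((polyIter (Φ R) j).comp (Φ x)).natDegree ^ w = (Φ y).natDegree ^ w
        rw [natDegree_comp, natDegree_polyIter, hΦR, natDegree_polyIter, mul_pow, hdegw, hdegw y,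
          ← pow_mul, ← pow_mul, ← pow_add]
        congr 1
        rw [← Nat.sub_add_cancel hle, hj]
        ring
      · have hRd : (polyIter (Φ R) j).natDegree ≠ 0 := by
          rw [natDegree_polyIter]
          exact pow_ne_zero _ (by have := hRcen.two_le; omega)
        rw [← hc, leadingCoeff_comp hRd, monic_polyIter hRcen.monic hRcen.two_le, one_pow, mul_one,
          hlc]
        rfl
    rcases le_total ((Φ x).natDegree.factorization q) ((Φ y).natDegree.factorization q)
      with hle | hle
    · exact main x y hlc hmod hle
    · obtain ⟨a, b, hab⟩ := main y x hlc.symm hmod.symm hle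
      exact ⟨b, a, hab.symm⟩

end Semigroup

section Conjugation

/-- Every polynomial of degree at least `2` is affinely conjugate to a centered one. -/
theorem exists_isCentered_conj {P : ℂ[X]} (hP : 2 ≤ P.natDegree) :
    ∃ a b : ℂ, a ≠ 0 ∧
      IsCentered ((C a⁻¹ * (X - C b)).comp (P.comp (C a * X + C b))) := by
  have hP0 : P ≠ 0 := by rintro rfl; simp at hP
  have hl : P.leadingCoeff ≠ 0 := leadingCoeff_ne_zero.2 hP0
  set n := P.natDegree with hn
  obtain ⟨a, ha⟩ := IsAlgClosed.exists_pow_nat_eq P.leadingCoeff⁻¹ (by omega : 0 < n - 1)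
  have ha0 : a ≠ 0 := by
    rintro rfl
    rw [zero_pow (by omega)] at ha
    exact inv_ne_zero hl ha.symm
  set b := -(P.coeff (n - 1)) / (n * P.leadingCoeff) with hb
  have hcomp : P.comp (C a * X + C b) = (taylor b P).comp (C a * X) := by
    rw [taylor_apply, comp_assoc]; simp
  have hcoeff : ∀ i, i ≠ 0 →
      ((C a⁻¹ * (X - C b)).comp (P.comp (C a * X + C b))).coeff i
        = a⁻¹ * ((taylor b P).coeff i * a ^ i) := fun i hi => by
    rw [hcomp, mul_comp, C_comp, sub_comp, X_comp, C_comp, coeff_C_mul, coeff_sub, coeff_C,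
      if_neg hi, sub_zero, comp_C_mul_X_coeff]
  have hdeg : ((C a⁻¹ * (X - C b)).comp (P.comp (C a * X + C b))).natDegree = n := by
    rw [natDegree_comp, natDegree_comp, natDegree_C_mul (inv_ne_zero ha0), natDegree_X_sub_C,
      natDegree_linear ha0, mul_one, one_mul]
  refine ⟨a, b, ha0, ?_, by rw [hdeg]; exact hP, ?_⟩
  · rw [Monic, leadingCoeff, hdeg, hcoeff n (by omega)]
    have : (taylor b P).coeff n = P.leadingCoeff := by
      rw [← leadingCoeff_taylor b P, leadingCoeff, natDegree_taylor]
    rw [this, ← Nat.sub_add_cancel (by omega : 1 ≤ n), pow_succ, ha]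
    field_simp
  · rw [nextCoeff_of_natDegree_pos (by omega), hdeg, hcoeff (n - 1) (by omega)]
    have : (taylor b P).coeff (n - 1) = 0 := by
      rw [taylor_coeff]
      have hlin : hasseDeriv (n - 1) P
          = C (n * P.leadingCoeff) * X + C (P.coeff (n - 1)) := by
        ext i
        rw [hasseDeriv_coeff, coeff_add, coeff_C_mul, coeff_X, coeff_C]
        rcases i with _ | _ | i
        · simp
        · have h1 : 0 + 1 + (n - 1) = n := by omega
          have h3 : n.choose (n - 1) = n := by
            rw [Nat.choose_symm (by omega : 1 ≤ n), Nat.choose_one_right]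
          rw [h1, h3]
          simp [hn]
        · rw [coeff_eq_zero_of_natDegree_lt (by omega)]
          simp
      have hn0 : (n : ℂ) ≠ 0 := Nat.cast_ne_zero.2 (by omega)
      rw [hlin, eval_add, eval_mul, eval_C, eval_X, eval_C, hb]
      field_simp
      ring
    rw [this, zero_mul, mul_zero]

theorem polyIter_conj {l l' : ℂ[X]} (h : l.comp l' = X) (h' : l'.comp l = X) (P : ℂ[X]) (k : ℕ) :
    polyIter (l'.comp (P.comp l)) k = l'.comp ((polyIter P k).comp l) := by
  induction k with
  | zero => simp [polyIter, h']
  | succ k ih =>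
    rw [polyIter, polyIter, ih]
    simp only [comp_assoc]
    rw [← comp_assoc l l', h, X_comp]

theorem InGen.exists_comm_polyIter {F : Set ℂ[X]} {P : ℂ[X]}
    (h : ∀ Q ∈ F, ∃ m n : ℕ, 1 ≤ m ∧ 1 ≤ n ∧ polyIter P m = polyIter Q n) {x : ℂ[X]}
    (hx : InGen F x) :
    ∃ k : ℕ, 1 ≤ k ∧ x.comp (polyIter P k) = (polyIter P k).comp x := by
  induction hx with
  | @base Q hQ =>
    obtain ⟨m, n, hm, -, e⟩ := h Q hQ
    exact ⟨m, hm, by rw [e]; exact comp_polyIter_of_comm rfl n⟩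
  | @comp A B _ _ ihA ihB =>
    obtain ⟨k, hk, hA⟩ := ihA
    obtain ⟨l, hl, hB⟩ := ihB
    refine ⟨k * l, Nat.mul_pos hk hl, ?_⟩
    have hA' := comp_polyIter_of_comm hA l
    have hB' := comp_polyIter_of_comm hB k
    rw [← polyIter_mul] at hA' hB'
    rw [mul_comm l k] at hB'
    rw [comp_assoc, hB', ← comp_assoc, hA', comp_assoc]

theorem InGen.exists_natDegree_pow {F : Set ℂ[X]} {P : ℂ[X]}
    (h : ∀ Q ∈ F, ∃ m n : ℕ, 1 ≤ m ∧ 1 ≤ n ∧ polyIter P m = polyIter Q n) {x : ℂ[X]}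
    (hx : InGen F x) : ∃ a b : ℕ, 1 ≤ a ∧ x.natDegree ^ a = P.natDegree ^ b := by
  induction hx with
  | @base Q hQ =>
    obtain ⟨m, n, -, hn, e⟩ := h Q hQ
    exact ⟨n, m, hn, by rw [← natDegree_polyIter, ← e, natDegree_polyIter]⟩
  | @comp A B _ _ ihA ihB =>
    obtain ⟨a, b, ha, hA⟩ := ihA
    obtain ⟨c, d, hc, hB⟩ := ihB
    refine ⟨a * c, b * c + d * a, Nat.mul_pos ha hc, ?_⟩
    rw [natDegree_comp, mul_pow, pow_mul, hA, mul_comm a c, pow_mul, hB, ← pow_mul, ← pow_mul,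
      ← pow_add]

end Conjugation

/-- If every pair in a non-exceptional family `F` of polynomials of degree at
least 2 shares a common iterate, then the semigroup `S(F)` is amenable and
every right-invariant mean on it is left-invariant. -/
theorem aip_implies_amenable (F : Set ℂ[X])
    (hdeg : ∀ P ∈ F, 2 ≤ P.natDegree)
    (hexc : ∃ P ∈ F, ¬IsExceptional P)
    (haip : ∀ P ∈ F, ∀ Q ∈ F,
      ∃ m n : ℕ, 1 ≤ m ∧ 1 ≤ n ∧ polyIter P m = polyIter Q n) :
    (∃ M : Mean (GenS F), M.RightInvariant ∧ M.LeftInvariant) ∧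
      (∀ M : Mean (GenS F), M.RightInvariant → M.LeftInvariant) := by
  obtain ⟨P, hPF, hPexc⟩ := hexc
  have hP2 := hdeg P hPF
  have hPQ := haip P hPF
  obtain ⟨a, b, ha, hcen⟩ := exists_isCentered_conj hP2
  set l : ℂ[X] := C a * X + C b with hl
  set l' : ℂ[X] := C a⁻¹ * (X - C b) with hl'
  have hll' : l.comp l' = X := by
    rw [hl, hl', add_comp, mul_comp, C_comp, C_comp, X_comp, ← mul_assoc, ← C_mul,
      mul_inv_cancel₀ ha, C_1, one_mul, sub_add_cancel]
  have hl'l : l'.comp l = X := by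
    rw [hl, hl', mul_comp, C_comp, sub_comp, X_comp, C_comp, add_sub_cancel_right, ← mul_assoc,
      ← C_mul, inv_mul_cancel₀ ha, C_1, one_mul]
  have hld : l.natDegree = 1 := natDegree_linear ha
  have hl'd : l'.natDegree = 1 := by
    rw [hl', natDegree_C_mul (inv_ne_zero ha), natDegree_X_sub_C]
  have hconj : ∀ Q : ℂ[X], l.comp (l'.comp (Q.comp l)) = Q.comp l := fun Q => by
    rw [← comp_assoc, hll', X_comp]
  have hcd : ∀ Q : ℂ[X], (l'.comp (Q.comp l)).natDegree = Q.natDegree := fun Q => by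
    rw [natDegree_comp, natDegree_comp, hld, hl'd, one_mul, mul_one]
  refine amenable_of_isCentered (S := GenS F) (Φ := fun x => l'.comp (x.1.comp l))
    (p := ⟨P, InGen.base hPF⟩) ?_ ?_ hcen ?_ ?_ ?_
  · intro x y hxy
    have h := congrArg l.comp hxy
    simp only [hconj] at h
    exact Subtype.ext (comp_right_cancel (by omega) h)
  · intro x y
    change l'.comp ((x.1.comp y.1).comp l) = _
    simp only [comp_assoc, hconj]
  · intro h
    refine hPexc (Or.inr ⟨a, b, ha, Or.inl ⟨P.natDegree, ?_⟩⟩)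
    have h' := congrArg l.comp h
    simp only [hconj, hcd] at h'
    exact h'
  · intro x
    obtain ⟨i, j, hi, hij⟩ := x.2.exists_natDegree_pow hPQ
    exact ⟨i, j, hi, by simpa only [hcd] using hij⟩
  · intro x
    obtain ⟨k, hk, hx⟩ := x.2.exists_comm_polyIter hPQ
    refine ⟨k, hk, ?_⟩
    rw [polyIter_conj hll' hl'l]
    simp only [comp_assoc, hconj]
    rw [← comp_assoc x.1, hx, comp_assoc]
end
end

section
/- Let S be a semigroup of polynomials over ℂ under composition in which every element has degree at least 2. If there exist a virtually cyclic group G and an injective semigroup homomorphism S → G, then any two elements P, Q ∈ S share a common iterate: there exist integers m, n ≥ 1 with P^∘m = Q^∘n. -/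
open Polynomial

noncomputable section

/-- A group is virtually cyclic if it has a cyclic subgroup of finite index. -/
def IsVirtuallyCyclic (G : Type*) [Group G] : Prop :=
  ∃ g : G, (Subgroup.zpowers g).index ≠ 0

/-- A map that is multiplicative on a composition semigroup sends iterates to powers. -/
theorem polyIter_mem_and_map_eq_pow {M : Type*} [Monoid M] {S : Set ℂ[X]} {f : ℂ[X] → M}
    (hclosed : ∀ P ∈ S, ∀ Q ∈ S, P.comp Q ∈ S)
    (hf : ∀ P ∈ S, ∀ Q ∈ S, f (P.comp Q) = f P * f Q) {P : ℂ[X]} (hP : P ∈ S)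
    {n : ℕ} (hn : 1 ≤ n) : polyIter P n ∈ S ∧ f (polyIter P n) = f P ^ n := by
  induction n, hn using Nat.le_induction with
  | base => simpa [polyIter] using hP
  | succ n _ ih =>
    exact ⟨hclosed _ hP _ ih.1, by rw [polyIter, hf _ hP _ ih.1, ih.2, pow_succ']⟩

/-- An injective multiplicative map on a composition semigroup of polynomials of degree at
least 2 omits the identity, since such a semigroup has no idempotents. -/
theorem map_ne_one_of_injOn {M : Type*} [Monoid M] {S : Set ℂ[X]} {f : ℂ[X] → M}
    (hclosed : ∀ P ∈ S, ∀ Q ∈ S, P.comp Q ∈ S) (hdeg : ∀ P ∈ S, 2 ≤ P.natDegree)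
    (hinj : Set.InjOn f S) (hf : ∀ P ∈ S, ∀ Q ∈ S, f (P.comp Q) = f P * f Q)
    {P : ℂ[X]} (hP : P ∈ S) : f P ≠ 1 := by
  intro h
  have hidem : P.comp P = P :=
    hinj (hclosed _ hP _ hP) hP (by rw [hf _ hP _ hP, h, one_mul])
  have hmul : P.natDegree * P.natDegree = P.natDegree := by
    rw [← natDegree_comp, hidem]
  nlinarith [hdeg P hP]

/-- If a semigroup `S` of polynomials of degree at least 2 (under composition)
embeds into a virtually cyclic group, then any two of its elements share a
common iterate. -/
theorem virtually_cyclic_implies_common_iterate (S : Set ℂ[X])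
    (hclosed : ∀ P ∈ S, ∀ Q ∈ S, P.comp Q ∈ S)
    (hdeg : ∀ P ∈ S, 2 ≤ P.natDegree)
    (hemb : ∃ (G : Type) (_ : Group G), IsVirtuallyCyclic G ∧
      ∃ f : ℂ[X] → G, Set.InjOn f S ∧
        ∀ P ∈ S, ∀ Q ∈ S, f (P.comp Q) = f P * f Q) :
    ∀ P ∈ S, ∀ Q ∈ S,
      ∃ m n : ℕ, 1 ≤ m ∧ 1 ≤ n ∧ polyIter P m = polyIter Q n := by
  obtain ⟨G, _, ⟨g, hg⟩, f, hinj, hf⟩ := hemb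
  have hne : ∀ R ∈ S, f R ≠ 1 := fun R hR => map_ne_one_of_injOn hclosed hdeg hinj hf hR
  have hiter : ∀ P ∈ S, ∀ n, 1 ≤ n → polyIter P n ∈ S ∧ f (polyIter P n) = f P ^ n :=
    fun P hP n hn => polyIter_mem_and_map_eq_pow hclosed hf hP hn
  intro P hP Q hQ
  obtain ⟨a, ha, -, i, hi⟩ := Subgroup.exists_pow_mem_of_index_ne_zero hg (f P)
  obtain ⟨b, hb, -, j, hj⟩ := Subgroup.exists_pow_mem_of_index_ne_zero hg (f Q)
  have hi0 : i ≠ 0 := by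
    rintro rfl
    obtain ⟨hmem, heq⟩ := hiter P hP a ha
    exact hne _ hmem (by rw [heq, ← hi]; simp)
  have hj0 : j ≠ 0 := by
    rintro rfl
    obtain ⟨hmem, heq⟩ := hiter Q hQ b hb
    exact hne _ hmem (by rw [heq, ← hj]; simp)
  have hm : 1 ≤ a * j.natAbs := Nat.mul_pos ha (Int.natAbs_pos.2 hj0)
  have hn : 1 ≤ b * i.natAbs := Nat.mul_pos hb (Int.natAbs_pos.2 hi0)
  obtain ⟨hPmem, hPf⟩ := hiter P hP _ hm
  obtain ⟨hQmem, hQf⟩ := hiter Q hQ _ hn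
  have hPg : f P ^ (a * j.natAbs) = g ^ (i * |j|) := by
    rw [pow_mul, ← hi, zpow_mul, Int.abs_eq_natAbs, zpow_natCast]
  have hQg : f Q ^ (b * i.natAbs) = g ^ (j * |i|) := by
    rw [pow_mul, ← hj, zpow_mul, Int.abs_eq_natAbs, zpow_natCast]
  have habs : |(i * |j|)| = |(j * |i|)| := by
    rw [abs_mul, abs_mul, abs_abs, abs_abs, mul_comm]
  rcases abs_eq_abs.1 habs with h | h
  · exact ⟨_, _, hm, hn, hinj hPmem hQmem (by rw [hPf, hQf, hPg, hQg, h])⟩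
  · refine absurd ?_ (hne _ (hclosed _ hPmem _ hQmem))
    rw [hf _ hPmem _ hQmem, hPf, hQf, hPg, hQg, h, zpow_neg, inv_mul_cancel]
end
end

section
/- Let S be a right-cancellative semigroup generated by finitely many elements s₁, …, s_m satisfying the Levin relations sᵢ·sⱼ = sᵢ·sᵢ for all i, j. If S admits a left-invariant mean, then S is cyclic; more precisely, all the generators coincide, so that S = {s₁^k : k ≥ 1}. -/
noncomputable section

/-- The `k`-th power `x^k` of an element of a semigroup, for `k ≥ 1`
(with the junk value `sgPow x 0 = x`). -/
def sgPow {S : Type*} [Semigroup S] (x : S) : ℕ → S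
  | 0 => x
  | 1 => x
  | n + 2 => sgPow x (n + 1) * x

/-- A left-invariant mean forces any two principal right ideals `aS`, `bS` to meet. -/
theorem Mean.LeftInvariant.exists_mul_eq_mul {S : Type*} [Semigroup S] {M : Mean S}
    (hM : M.LeftInvariant) (a b : S) : ∃ x y : S, a * x = b * y := by
  classical
  by_contra! hdisj
  let ind : S → S → ℝ := fun c z => if ∃ x, z = c * x then 1 else 0
  have ind_cases (c z : S) : ind c z = 0 ∨ ind c z = 1 := by
    simp only [ind]; split_ifs <;> simp
  have bdd_ind (c : S) : Bddf (ind c) :=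
    ⟨1, fun z => by rcases ind_cases c z with h | h <;> simp [h]⟩
  have mean_ind (c : S) : M.toFun (ind c) = 1 := by
    rw [← hM c _ (bdd_ind c), ← M.norm_one]
    congr 1
    funext x
    exact if_pos ⟨x, rfl⟩
  have bdd_one : Bddf (fun _ : S => (1 : ℝ)) := ⟨1, fun _ => by simp⟩
  have bdd_add : Bddf (ind a + ind b) := by
    refine ⟨2, fun z => ?_⟩
    rcases ind_cases a z with h | h <;> rcases ind_cases b z with h' | h' <;>
      norm_num [h, h']
  have bdd_neg : Bddf ((-1 : ℝ) • (ind a + ind b)) := by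
    obtain ⟨C, hC⟩ := bdd_add
    exact ⟨C, fun z => by simpa only [Pi.smul_apply, neg_smul, one_smul, abs_neg] using hC z⟩
  have bdd_sub : Bddf ((fun _ => (1 : ℝ)) + (-1 : ℝ) • (ind a + ind b)) := by
    obtain ⟨C, hC⟩ := bdd_neg
    exact ⟨1 + C, fun z => (abs_add_le _ _).trans (by simpa using hC z)⟩
  have key := M.nonneg _ bdd_sub fun z => by
    have hz : ind a z + ind b z ≤ 1 := by
      by_cases ha : ∃ x, z = a * x
      · have hb : ¬ ∃ y, z = b * y := by
          obtain ⟨x, rfl⟩ := ha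
          rintro ⟨y, hy⟩
          exact hdisj x y hy
        simp [ind, ha, hb]
      · rcases ind_cases b z with h | h <;> simp [ind, ha] at h ⊢ <;> simp [h]
    simp only [Pi.add_apply, Pi.smul_apply, smul_eq_mul]
    linarith
  rw [M.map_add _ _ bdd_one bdd_neg, M.map_smul _ _ bdd_add,
    M.map_add _ _ (bdd_ind a) (bdd_ind b), mean_ind, mean_ind, M.norm_one] at key
  linarith

theorem sgPow_succ_mul_of_mul_eq {S : Type*} [Semigroup S] {a b : S} (h : a * b = a * a)
    (n : ℕ) : sgPow a (n + 1) * b = sgPow a (n + 2) := by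
  cases n with
  | zero => exact h
  | succ n => simp only [sgPow, mul_assoc, h]

theorem sgPow_succ_mul_sgPow_succ {S : Type*} [Semigroup S] {a b : S} (h : a * b = a * a)
    (n k : ℕ) : sgPow a (n + 1) * sgPow b (k + 1) = sgPow a (n + k + 2) := by
  induction k with
  | zero => exact sgPow_succ_mul_of_mul_eq h n
  | succ k ih =>
    rw [sgPow, ← mul_assoc, ih]
    exact sgPow_succ_mul_of_mul_eq h (n + k + 1)

theorem mul_sgPow_succ {S : Type*} [Semigroup S] {a b : S} (h : a * b = a * a) (k : ℕ) :
    a * sgPow b (k + 1) = sgPow a (k + 2) := by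
  simpa only [zero_add, sgPow] using sgPow_succ_mul_sgPow_succ h 0 k

theorem eq_of_sgPow_eq_of_le {S : Type*} [Semigroup S]
    (hrc : ∀ a x y : S, x * a = y * a → x = y) {a b : S}
    (hab : a * b = a * a) (hba : b * a = b * b) {p q : ℕ} (hpq : p ≤ q)
    (h : sgPow a (p + 1) = sgPow b (q + 1)) : a = b := by
  obtain ⟨r, hr⟩ : ∃ r, a = sgPow b (r + 1) := by
    cases p with
    | zero => exact ⟨q, h⟩
    | succ p =>
      obtain ⟨r, rfl⟩ := Nat.exists_eq_add_of_le' hpq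
      refine ⟨r, hrc (sgPow a (p + 1)) _ _ ?_⟩
      rw [sgPow_succ_mul_sgPow_succ hba]
      exact (mul_sgPow_succ rfl p).trans h
  have hcomm : b * a = a * b := by
    rw [hr]
    exact mul_sgPow_succ rfl r
  exact hrc a a b (hab.symm.trans hcomm.symm)

theorem exists_eq_sgPow_of_levin {S : Type*} [Semigroup S] {ι : Type*} {s : ι → S}
    (hgen : Subsemigroup.closure (Set.range s) = ⊤)
    (hlevin : ∀ i j, s i * s j = s i * s i) (x : S) :
    ∃ i n, x = sgPow (s i) (n + 1) := by
  have hx : x ∈ Subsemigroup.closure (Set.range s) := hgen ▸ Subsemigroup.mem_top x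
  induction hx using Subsemigroup.closure_induction with
  | mem x hx =>
    obtain ⟨i, rfl⟩ := hx
    exact ⟨i, 0, rfl⟩
  | mul x y _ _ hx hy =>
    obtain ⟨i, n, rfl⟩ := hx
    obtain ⟨j, k, rfl⟩ := hy
    exact ⟨i, n + k + 1, sgPow_succ_mul_sgPow_succ (hlevin i j) n k⟩

/-- A finitely generated right-cancellative semigroup whose generators satisfy
the Levin relations and which admits a left-invariant mean is cyclic: all the
generators coincide and every element is a power `s₁^k`, `k ≥ 1`, of the first
generator. -/
theorem levin_left_amenable_cyclic {S : Type*} [Semigroup S]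
    (hrc : ∀ a x y : S, x * a = y * a → x = y)
    (m : ℕ) (hm : 0 < m) (s : Fin m → S)
    (hgen : Subsemigroup.closure (Set.range s) = ⊤)
    (hlevin : ∀ i j, s i * s j = s i * s i)
    (hla : ∃ M : Mean S, M.LeftInvariant) :
    (∀ i j, s i = s j) ∧
      ∀ x : S, ∃ k : ℕ, 1 ≤ k ∧ x = sgPow (s ⟨0, hm⟩) k := by
  obtain ⟨M, hM⟩ := hla
  have hmul (i : Fin m) (x : S) : ∃ n, s i * x = sgPow (s i) (n + 1) := by
    obtain ⟨j, n, rfl⟩ := exists_eq_sgPow_of_levin hgen hlevin x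
    exact ⟨n + 1, mul_sgPow_succ (hlevin i j) n⟩
  have hall (i j : Fin m) : s i = s j := by
    obtain ⟨x, y, hxy⟩ := hM.exists_mul_eq_mul (s i) (s j)
    obtain ⟨p, hp⟩ := hmul i x
    obtain ⟨q, hq⟩ := hmul j y
    have h : sgPow (s i) (p + 1) = sgPow (s j) (q + 1) := hp.symm.trans (hxy.trans hq)
    rcases le_total p q with hpq | hqp
    · exact eq_of_sgPow_eq_of_le hrc (hlevin i j) (hlevin j i) hpq h
    · exact (eq_of_sgPow_eq_of_le hrc (hlevin j i) (hlevin i j) hqp h.symm).symm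
  refine ⟨hall, fun x => ?_⟩
  obtain ⟨i, n, rfl⟩ := exists_eq_sgPow_of_levin hgen hlevin x
  exact ⟨n + 1, by omega, by rw [hall i ⟨0, hm⟩]⟩
end
end

section
/- Let S be a right-cancellative semigroup and let s, t ∈ S satisfy the Levin relations s·t = s·s and t·s = t·t. Then either s = t, or the cyclic subsemigroups generated by s and t are disjoint: {s^k : k ≥ 1} ∩ {t^k : k ≥ 1} = ∅. -/
noncomputable section

theorem sgPow_succ {S : Type*} [Semigroup S] (x : S) {n : ℕ} (hn : 1 ≤ n) :
    sgPow x (n + 1) = sgPow x n * x := by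
  obtain ⟨n, rfl⟩ := Nat.exists_eq_add_of_le' hn
  rfl

theorem sgPow_mul_of_mul_eq {S : Type*} [Semigroup S] {s t : S} (h : s * t = s * s)
    {n : ℕ} (hn : 1 ≤ n) : sgPow s n * t = sgPow s (n + 1) := by
  obtain ⟨n, rfl⟩ := Nat.exists_eq_add_of_le' hn
  cases n with
  | zero => exact h
  | succ n =>
    rw [sgPow_succ s hn, sgPow_succ s n.succ_pos, mul_assoc, h, ← mul_assoc]

theorem sgPow_mul_sgPow_of_mul_eq {S : Type*} [Semigroup S] {s t : S} (h : s * t = s * s)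
    {m n : ℕ} (hm : 1 ≤ m) (hn : 1 ≤ n) : sgPow s m * sgPow t n = sgPow s (m + n) := by
  induction n, hn using Nat.le_induction with
  | base => exact sgPow_mul_of_mul_eq h hm
  | succ n hn ih =>
    rw [sgPow_succ t hn, ← mul_assoc, ih, sgPow_mul_of_mul_eq h (by omega), add_assoc]

/-- In a right-cancellative semigroup, two elements satisfying the Levin
relations `s·t = s·s` and `t·s = t·t` are either equal or generate disjoint
cyclic subsemigroups `{s^k : k ≥ 1}` and `{t^k : k ≥ 1}`. -/
theorem levin_dichotomy {S : Type*} [Semigroup S]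
    (hrc : ∀ a x y : S, x * a = y * a → x = y)
    (s t : S) (h1 : s * t = s * s) (h2 : t * s = t * t) :
    s = t ∨ {x : S | ∃ k : ℕ, 1 ≤ k ∧ x = sgPow s k} ∩
      {x : S | ∃ k : ℕ, 1 ≤ k ∧ x = sgPow t k} = ∅ := by
  refine or_iff_not_imp_right.mpr fun hne => ?_
  obtain ⟨x, ⟨m, hm, hxs⟩, n, hn, hxt⟩ := Set.nonempty_iff_ne_empty.mpr hne
  have hmn : sgPow s m = sgPow t n := hxs.symm.trans hxt
  have hpow : sgPow s (m + n) = sgPow t (m + n) := by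
    rw [← sgPow_mul_sgPow_of_mul_eq h1 hm hn, add_comm m n,
      ← sgPow_mul_sgPow_of_mul_eq h2 hn hm, hmn]
  obtain ⟨k, hk, hmk⟩ : ∃ k, 1 ≤ k ∧ m + n = 1 + k := ⟨m + n - 1, by omega, by omega⟩
  rw [hmk, ← sgPow_mul_sgPow_of_mul_eq h1 le_rfl hk,
    ← sgPow_mul_sgPow_of_mul_eq (rfl : t * t = t * t) le_rfl hk] at hpow
  exact hrc _ _ _ hpow
end
end

section
/- Let P and Q be polynomials over ℂ of degree at least 2 satisfying the Levin relations P∘Q = P∘P and Q∘P = Q∘Q. If there exists a point z₀ ∈ ℂ such that the intersection O_P(z₀) ∩ O_Q(z₀) of the forward orbits of z₀ under P and under Q is infinite, then P = Q. -/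
open Polynomial

noncomputable section

theorem eval_polyIter (P : ℂ[X]) (n : ℕ) (z : ℂ) :
    (polyIter P n).eval z = (fun w => P.eval w)^[n] z := by
  induction n with
  | zero => simp [polyIter]
  | succ n ih => rw [polyIter, eval_comp, ih, Function.iterate_succ_apply']

/-- If `f ∘ g = f ∘ f`, then `f ∘ g^[n] = f^[n + 1]`. -/
theorem apply_iterate_of_comp_eq {α : Type*} {f g : α → α} (h : ∀ w, f (g w) = f (f w))
    (n : ℕ) (z : α) : f (g^[n] z) = f^[n + 1] z := by
  induction n with
  | zero => rfl
  | succ n ih => rw [Function.iterate_succ_apply', h, ih, ← Function.iterate_succ_apply' f]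

/-- An infinite forward orbit has no coincidences. -/
theorem iterate_injective_of_infinite_range {α : Type*} {f : α → α} {z : α}
    (h : (Set.range fun n : ℕ => f^[n] z).Infinite) :
    Function.Injective fun n : ℕ => f^[n] z := by
  refine Function.Injective.of_lt_imp_ne fun m n hmn heq => h ?_
  refine ((Set.finite_Iio n).image fun k => f^[k] z).subset ?_
  rintro _ ⟨k, rfl⟩
  induction k using Nat.strong_induction_on with
  | _ k ih =>
    by_cases hk : k < n
    · exact ⟨k, hk, rfl⟩
    · have hshift : f^[k] z = f^[k - n + m] z := by
        rw [Function.iterate_add_apply, show f^[m] z = f^[n] z from heq,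
          ← Function.iterate_add_apply, Nat.sub_add_cancel (not_lt.mp hk)]
      simp only [hshift]
      exact ih _ (by omega)

/-- If `f ∘ g = f ∘ f`, `g ∘ f = g ∘ g` and the forward orbits of `z` under `f` and `g` have
infinite intersection, then `f` and `g` agree at infinitely many points. -/
theorem infinite_setOf_eq_of_infinite_inter_orbits {α : Type*} {f g : α → α} {z : α}
    (hfg : ∀ w, f (g w) = f (f w)) (hgf : ∀ w, g (f w) = g (g w))
    (hz : ((Set.range fun n : ℕ => f^[n] z) ∩ Set.range fun n : ℕ => g^[n] z).Infinite) :
    {w | f w = g w}.Infinite := by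
  have hinj := iterate_injective_of_infinite_range (hz.mono Set.inter_subset_left)
  refine fun hfin => hz (((hfin.image f).insert z).subset ?_)
  rintro _ ⟨⟨n, rfl⟩, ⟨m, hm⟩⟩
  replace hm : g^[m] z = f^[n] z := hm
  have hnm : m + 1 = n + 1 := hinj <| by
    simp only [← apply_iterate_of_comp_eq hfg m z, Function.iterate_succ_apply' f n, hm]
  obtain rfl : m = n := by omega
  cases m with
  | zero => exact Or.inl rfl
  | succ k =>
    refine Or.inr ⟨f^[k] z, ?_, (Function.iterate_succ_apply' f k z).symm⟩
    change f _ = g _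
    rw [apply_iterate_of_comp_eq hgf k z, hm, Function.iterate_succ_apply']

/-- Two polynomials of degree at least 2 satisfying the Levin relations that
have the dynamical intersection property are equal. -/
theorem levin_dip_implies_equal (P Q : ℂ[X])
    (hP : 2 ≤ P.natDegree) (hQ : 2 ≤ Q.natDegree)
    (h1 : P.comp Q = P.comp P) (h2 : Q.comp P = Q.comp Q)
    (hdip : ∃ z₀ : ℂ, (fwdOrbit P z₀ ∩ fwdOrbit Q z₀).Infinite) :
    P = Q := by
  obtain ⟨z, hz⟩ := hdip
  simp only [fwdOrbit, eval_polyIter] at hz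
  refine eq_of_infinite_eval_eq P Q (infinite_setOf_eq_of_infinite_inter_orbits
    (fun w => ?_) (fun w => ?_) hz)
  · simp only [← eval_comp, h1]
  · simp only [← eval_comp, h2]
end
end
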